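/- arXiv:1609.03046 — 4 statements merged into one kernel-verified Lean document; each statement's English description precedes it below -/
import Mathlib

section
/- Linear form of Lemma 2.3 (centralizer of PSO(Q_d; d−1,1)): let d ≥ 2 and let G be the group of all invertible (d+1)×(d+1) real matrices g such that Q_d(g·x) = Q_d(x) for every x ∈ ℝ^{d+1} and g·e₂ = e₂, where e₂ is the second standard basis vector. Then an invertible (d+1)×(d+1) real matrix B commutes with every element of G if and only if there exist nonzero real numbers μ and ν such that B is the diagonal matrix whose (2,2) entry is ν and whose remaining diagonal entries all equal μ. (Consequently the identity component of the centralizer in PGL_{d+1}(ℝ) is the one-parameter group c_t = exp(tC) with C = diag(−1, d, −1, …, −1).) -/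
/-- The quadratic form `Q_d(x) = x₂² + ⋯ + x_d² − 2 x₁ x_{d+1}` on `ℝ^{d+1}`
(coordinates indexed `0, …, d` here). -/
noncomputable def Qd (d : ℕ) (x : Fin (d + 1) → ℝ) : ℝ :=
  (∑ k ∈ Finset.univ.filter (fun k : Fin (d + 1) => 1 ≤ k.val ∧ k.val < d), x k ^ 2)
    - 2 * x 0 * x (Fin.last d)

/-- The second standard basis vector `e₂` of `ℝ^{d+1}` (index `1` here). -/
def stdE2 (d : ℕ) : Fin (d + 1) → ℝ := fun k => if k.val = 1 then 1 else 0

/-- Polarization of `Q_d` against `e₂` recovers the second coordinate. -/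
theorem Qd_add_stdE2 {d : ℕ} (hd : 2 ≤ d) (x : Fin (d + 1) → ℝ) :
    Qd d (x + stdE2 d) = Qd d x + 2 * x ⟨1, by omega⟩ + 1 := by
  have hmem : (⟨1, by omega⟩ : Fin (d + 1)) ∈
      Finset.univ.filter (fun k : Fin (d + 1) => 1 ≤ k.val ∧ k.val < d) := by
    simp; omega
  have hd1 : d ≠ 1 := by omega
  unfold Qd
  rw [← Finset.add_sum_erase _ _ hmem, ← Finset.add_sum_erase _ _ hmem,
    Finset.sum_congr rfl (g := fun k => x k ^ 2)]
  · simp [stdE2, hd1]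
    ring
  · intro k hk
    have hk1 : k.val ≠ 1 := fun h => (Finset.mem_erase.mp hk).1 (Fin.ext h)
    simp [stdE2, hk1]

/-- A `Q_d`-orthogonal matrix fixing `e₂` preserves the second coordinate. -/
theorem mulVec_apply_one_of_Qd_mulVec {d : ℕ} (hd : 2 ≤ d)
    {g : Matrix (Fin (d + 1)) (Fin (d + 1)) ℝ}
    (hQ : ∀ x : Fin (d + 1) → ℝ, Qd d (g.mulVec x) = Qd d x)
    (he : g.mulVec (stdE2 d) = stdE2 d) (x : Fin (d + 1) → ℝ) :
    g.mulVec x ⟨1, by omega⟩ = x ⟨1, by omega⟩ := by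
  have h := hQ (x + stdE2 d)
  rw [Matrix.mulVec_add, he, Qd_add_stdE2 hd, Qd_add_stdE2 hd, hQ] at h
  linarith

theorem Qd_diagonal_mulVec {d : ℕ} {a : Fin (d + 1) → ℝ} (h0 : a 0 * a (Fin.last d) = 1)
    (ha : ∀ k : Fin (d + 1), 1 ≤ k.val → k.val < d → a k ^ 2 = 1) (x : Fin (d + 1) → ℝ) :
    Qd d ((Matrix.diagonal a).mulVec x) = Qd d x := by
  simp only [Qd, Matrix.mulVec_diagonal]
  congr 1
  · refine Finset.sum_congr rfl fun k hk => ?_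
    obtain ⟨h1, h2⟩ := (Finset.mem_filter.mp hk).2
    rw [mul_pow, ha k h1 h2, one_mul]
  · linear_combination (2 * x 0 * x (Fin.last d)) * h0

theorem diagonal_mulVec_stdE2 {d : ℕ} {a : Fin (d + 1) → ℝ}
    (ha : ∀ k : Fin (d + 1), k.val = 1 → a k = 1) :
    (Matrix.diagonal a).mulVec (stdE2 d) = stdE2 d := by
  ext k
  by_cases hk : k.val = 1 <;> simp [Matrix.mulVec_diagonal, stdE2, hk, ha]

theorem apply_eq_zero_of_commute_diagonal {n R : Type*} [Fintype n] [DecidableEq n]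
    [CommRing R] [IsDomain R] {B : Matrix n n R} {a : n → R}
    (h : B * Matrix.diagonal a = Matrix.diagonal a * B) {i j : n} (hij : a i ≠ a j) :
    B i j = 0 := by
  have h' := congrFun (congrFun h i) j
  rw [Matrix.mul_diagonal, Matrix.diagonal_mul] at h'
  have h0 : (a i - a j) * B i j = 0 := by linear_combination -h'
  exact (mul_eq_zero.mp h0).resolve_left (sub_ne_zero.mpr hij)

theorem one_sub_vecMulVec_mulVec {n R : Type*} [Fintype n] [DecidableEq n] [CommRing R]
    (v w x : n → R) :
    (1 - Matrix.vecMulVec v w).mulVec x = x - (w ⬝ᵥ x) • v := by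
  rw [Matrix.sub_mulVec, Matrix.one_mulVec, Matrix.vecMulVec_mulVec]
  ext i
  simp [mul_comm]

theorem isUnit_one_sub_vecMulVec {n R : Type*} [Fintype n] [DecidableEq n] [CommRing R]
    {v w : n → R} (h : w ⬝ᵥ v = 2) : IsUnit (1 - Matrix.vecMulVec v w) := by
  refine IsUnit.of_mul_eq_one (1 - Matrix.vecMulVec v w) ?_
  have hsq : Matrix.vecMulVec v w * Matrix.vecMulVec v w = (2 : R) • Matrix.vecMulVec v w := by
    rw [Matrix.vecMulVec_mul_vecMulVec, h]
    ext i j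
    simp [Matrix.vecMulVec_apply, mul_left_comm]
  rw [sub_mul, one_mul, mul_sub, mul_one, hsq, two_smul]
  abel

theorem eq_of_diagonal_commute_one_sub_vecMulVec {n R : Type*} [Fintype n] [DecidableEq n]
    [CommRing R] [IsDomain R] {b v w : n → R}
    (h : Matrix.diagonal b * (1 - Matrix.vecMulVec v w) =
      (1 - Matrix.vecMulVec v w) * Matrix.diagonal b)
    {i j : n} (hi : v i ≠ 0) (hj : w j ≠ 0) : b i = b j := by
  have h' : Matrix.diagonal b * Matrix.vecMulVec v w =
      Matrix.vecMulVec v w * Matrix.diagonal b := by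
    simpa [mul_sub, sub_mul] using h
  have h' := congrFun (congrFun h' i) j
  rw [Matrix.mul_diagonal, Matrix.diagonal_mul, Matrix.vecMulVec_apply] at h'
  exact mul_right_cancel₀ (mul_ne_zero hi hj) (h'.trans (mul_comm _ _))

theorem Qd_sub_smul_swap {d : ℕ} (hd : 2 ≤ d) (x : Fin (d + 1) → ℝ) :
    Qd d (x - (x 0 - x (Fin.last d)) •
      (Pi.single 0 1 - Pi.single (Fin.last d) 1 : Fin (d + 1) → ℝ)) = Qd d x := by
  have hl : Fin.last d ≠ 0 := by simp only [ne_eq, Fin.ext_iff, Fin.val_zero, Fin.val_last]; omega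
  unfold Qd
  rw [Finset.sum_congr rfl (g := fun k => x k ^ 2)]
  · simp [hl, hl.symm]
    ring
  · intro k hk
    obtain ⟨h1, h2⟩ := (Finset.mem_filter.mp hk).2
    have hk0 : k ≠ 0 := by simp only [ne_eq, Fin.ext_iff, Fin.val_zero]; omega
    have hkl : k ≠ Fin.last d := by simp only [ne_eq, Fin.ext_iff, Fin.val_last]; omega
    simp [hk0, hkl]

theorem Qd_sub_smul_reflection {d : ℕ} {k : Fin (d + 1)} (hk1 : 1 ≤ k.val) (hkd : k.val < d)
    (x : Fin (d + 1) → ℝ) :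
    Qd d (x - (2 * (x k - x (Fin.last d))) •
      (Pi.single 0 1 + Pi.single k 1 : Fin (d + 1) → ℝ)) = Qd d x := by
  have hl : Fin.last d ≠ 0 := by simp only [ne_eq, Fin.ext_iff, Fin.val_zero, Fin.val_last]; omega
  have hk0 : k ≠ 0 := by simp only [ne_eq, Fin.ext_iff, Fin.val_zero]; omega
  have hkl : k ≠ Fin.last d := by simp only [ne_eq, Fin.ext_iff, Fin.val_last]; omega
  have hmem : k ∈ Finset.univ.filter (fun k : Fin (d + 1) => 1 ≤ k.val ∧ k.val < d) := by
    simp [hk1, hkd]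
  unfold Qd
  rw [← Finset.add_sum_erase _ _ hmem, ← Finset.add_sum_erase _ _ hmem,
    Finset.sum_congr rfl (g := fun k => x k ^ 2)]
  · simp [hl, hk0, hk0.symm, hkl.symm]
    ring
  · intro j hj
    obtain ⟨hjk, hj⟩ := Finset.mem_erase.mp hj
    obtain ⟨h1, h2⟩ := (Finset.mem_filter.mp hj).2
    have hj0 : j ≠ 0 := by simp only [ne_eq, Fin.ext_iff, Fin.val_zero]; omega
    simp [hj0, hjk]

/-- Commuting with the stabilizer of `e₂` in `O(Q_d)` forces a matrix to be diagonal: the boost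
`diag(2, 1, …, 1, 1/2)` and the reflections in the basis vectors separate the coordinates. -/
theorem eq_diagonal_of_commute {d : ℕ} (hd : 2 ≤ d)
    {B : Matrix (Fin (d + 1)) (Fin (d + 1)) ℝ}
    (h : ∀ g : Matrix (Fin (d + 1)) (Fin (d + 1)) ℝ, IsUnit g →
        (∀ x : Fin (d + 1) → ℝ, Qd d (g.mulVec x) = Qd d x) →
        g.mulVec (stdE2 d) = stdE2 d → B * g = g * B) :
    B = Matrix.diagonal B.diag := by
  have hdiag : ∀ a : Fin (d + 1) → ℝ, (∀ k, a k ≠ 0) → a 0 * a (Fin.last d) = 1 →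
      (∀ k : Fin (d + 1), 1 ≤ k.val → k.val < d → a k ^ 2 = 1) →
      (∀ k : Fin (d + 1), k.val = 1 → a k = 1) → ∀ i j, a i ≠ a j → B i j = 0 :=
    fun a hne h0 ha h1 i j hij => apply_eq_zero_of_commute_diagonal
      (h _ (Matrix.isUnit_diagonal.mpr (Pi.isUnit_iff.mpr fun k => (hne k).isUnit))
        (Qd_diagonal_mulVec h0 ha) (diagonal_mulVec_stdE2 h1)) hij
  have hboost := hdiag (fun k => if k.val = 0 then 2 else if k.val = d then 1 / 2 else 1)
    (by intro k; split_ifs <;> norm_num)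
    (by have : d ≠ 0 := by omega
        simp [this])
    (by intro k h1 h2
        simp [show k.val ≠ 0 by omega, show k.val ≠ d by omega])
    (by intro k h1
        simp [h1, show 1 ≠ d by omega])
  have hrefl : ∀ k : Fin (d + 1), 2 ≤ k.val → k.val < d → ∀ i j,
      (if i = k then (-1 : ℝ) else 1) ≠ (if j = k then -1 else 1) → B i j = 0 := by
    intro k hk2 hkd
    refine hdiag (fun i => if i = k then -1 else 1) ?_ ?_ ?_ ?_
    · intro i; split_ifs <;> norm_num
    · have h0 : (0 : Fin (d + 1)) ≠ k := by simp only [ne_eq, Fin.ext_iff, Fin.val_zero]; omega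
      have hl : Fin.last d ≠ k := by simp only [ne_eq, Fin.ext_iff, Fin.val_last]; omega
      simp [h0, hl]
    · intro i _ _; split_ifs <;> norm_num
    · intro i hi
      have : i ≠ k := by simp only [ne_eq, Fin.ext_iff]; omega
      simp [this]
  ext i j
  by_cases hij : i = j
  · subst hij; simp
  rw [Matrix.diagonal_apply_ne _ hij]
  have hv : i.val ≠ j.val := fun e => hij (Fin.ext e)
  by_cases hi : 2 ≤ i.val ∧ i.val < d
  · exact hrefl i hi.1 hi.2 i j (by simp [Ne.symm hij]; norm_num)
  by_cases hj : 2 ≤ j.val ∧ j.val < d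
  · exact hrefl j hj.1 hj.2 i j (by simp [hij]; norm_num)
  apply hboost
  have := i.isLt
  have := j.isLt
  split_ifs <;> first | omega | norm_num

/-- Linear form of Lemma 2.3 (centralizer of `PSO(Q_d; d−1,1)`): an invertible matrix `B`
commutes with every invertible matrix preserving `Q_d` and fixing `e₂` if and only if `B`
is diagonal with `(2,2)` entry `ν ≠ 0` and all other diagonal entries equal to `μ ≠ 0`. -/
theorem centralizer_PSOQd (d : ℕ) (hd : 2 ≤ d)
    (B : Matrix (Fin (d + 1)) (Fin (d + 1)) ℝ) (hB : IsUnit B) :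
    (∀ g : Matrix (Fin (d + 1)) (Fin (d + 1)) ℝ, IsUnit g →
        (∀ x : Fin (d + 1) → ℝ, Qd d (g.mulVec x) = Qd d x) →
        g.mulVec (stdE2 d) = stdE2 d → B * g = g * B) ↔
      ∃ μ ν : ℝ, μ ≠ 0 ∧ ν ≠ 0 ∧
        B = Matrix.diagonal (fun i : Fin (d + 1) => if i.val = 1 then ν else μ) := by
  have hl : Fin.last d ≠ 0 := by simp only [ne_eq, Fin.ext_iff, Fin.val_zero, Fin.val_last]; omega
  constructor
  · intro h
    have hBd := eq_diagonal_of_commute hd h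
    set b := B.diag with hb
    have hb0 : ∀ i, b i ≠ 0 := by
      rw [hBd, Matrix.isUnit_diagonal, Pi.isUnit_iff] at hB
      exact fun i => (hB i).ne_zero
    have hrefl : ∀ v w : Fin (d + 1) → ℝ, w ⬝ᵥ v = 2 → w ⬝ᵥ stdE2 d = 0 →
        (∀ x, Qd d (x - (w ⬝ᵥ x) • v) = Qd d x) → ∀ i j, v i ≠ 0 → w j ≠ 0 → b i = b j := by
      intro v w hwv hwe hQ i j hi hj
      have hc := h _ (isUnit_one_sub_vecMulVec hwv)
        (fun x => by rw [one_sub_vecMulVec_mulVec, hQ])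
        (by rw [one_sub_vecMulVec_mulVec, hwe, zero_smul, sub_zero])
      rw [hBd] at hc
      exact eq_of_diagonal_commute_one_sub_vecMulVec hc hi hj
    have hlast : b 0 = b (Fin.last d) := by
      refine hrefl (Pi.single 0 1 - Pi.single (Fin.last d) 1)
        (Pi.single 0 1 - Pi.single (Fin.last d) 1) ?_ ?_ ?_ _ _ ?_ ?_
      · simp [hl, hl.symm]
        norm_num
      · simp [sub_dotProduct, stdE2]
        omega
      · intro x
        simpa [sub_dotProduct] using Qd_sub_smul_swap hd x
      · simp [hl.symm]
      · simp [hl]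
    have hmid : ∀ k : Fin (d + 1), 2 ≤ k.val → k.val < d → b 0 = b k := by
      intro k hk2 hkd
      have hk0 : k ≠ 0 := by simp only [ne_eq, Fin.ext_iff, Fin.val_zero]; omega
      have hkl : k ≠ Fin.last d := by simp only [ne_eq, Fin.ext_iff, Fin.val_last]; omega
      refine hrefl (Pi.single 0 1 + Pi.single k 1)
        ((2 : ℝ) • (Pi.single k 1 - Pi.single (Fin.last d) 1)) ?_ ?_ ?_ _ _ ?_ ?_
      · simp [hl, hk0, hkl.symm]
      · simp [sub_dotProduct, stdE2, show k.val ≠ 1 by omega, show d ≠ 1 by omega]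
      · intro x
        simpa [sub_dotProduct] using Qd_sub_smul_reflection (by omega) hkd x
      · simp [hk0.symm]
      · simp [hkl]
    refine ⟨b 0, b ⟨1, by omega⟩, hb0 _, hb0 _, hBd.trans (congrArg _ (funext fun i => ?_))⟩
    split_ifs with hi
    · exact congrArg b (Fin.ext hi)
    by_cases hi0 : i.val = 0
    · exact congrArg b (Fin.ext hi0)
    by_cases hid : i.val = d
    · rw [hlast]
      exact congrArg b (Fin.ext hid)
    · exact (hmid i (by omega) (by omega)).symm
  · rintro ⟨μ, ν, -, -, rfl⟩ g - hQ he
    ext i j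
    rw [Matrix.diagonal_mul, Matrix.mul_diagonal]
    have hrow : i.val = 1 → j.val ≠ 1 → g i j = 0 := by
      intro hi hj
      have h := mulVec_apply_one_of_Qd_mulVec hd hQ he (Pi.single j 1)
      rw [← show i = ⟨1, by omega⟩ from Fin.ext hi] at h
      rw [Matrix.mulVec_single_one, Matrix.col_apply] at h
      rw [h, Pi.single_eq_of_ne (fun e => hj ((congrArg Fin.val e).symm.trans hi))]
    have hcol : i.val ≠ 1 → j.val = 1 → g i j = 0 := by
      intro hi hj
      have hs : stdE2 d = Pi.single j 1 := by
        ext k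
        simp [stdE2, Pi.single_apply, Fin.ext_iff, hj]
      have h := congrFun he i
      rw [hs, Matrix.mulVec_single_one, Matrix.col_apply] at h
      rw [h, Pi.single_eq_of_ne (fun e => hi ((congrArg Fin.val e).trans hj))]
    by_cases hi : i.val = 1 <;> by_cases hj : j.val = 1
    · simp [hi, hj, mul_comm]
    · simp [hrow hi hj]
    · simp [hcol hi hj]
    · simp [hi, hj, mul_comm]
end

section
/- Lemma 2.4 (centralizer of P_d in PGL_{d+1}(ℝ)): let d ≥ 2 and let B be an invertible (d+1)×(d+1) real matrix. Suppose that for every v ∈ ℝ^{d−1} there is a nonzero real number λ(v) with B·M(v) = λ(v)·(M(v)·B). Then there exist a nonzero real number c, a vector u ∈ ℝ^{d−1} and a real number b such that B = c·E(u,b), where E(u,b) is the matrix with entries E_{1,1} = 1, E_{1,j} = u_{j−1} for 2 ≤ j ≤ d, E_{1,d+1} = b, E_{i,i} = 1 and E_{i,d+1} = u_{i−1} for 2 ≤ i ≤ d, E_{d+1,d+1} = 1, and all other entries 0. Conversely, every matrix of the form c·E(u,b) with c ≠ 0 satisfies B·M(v) = M(v)·B for all v ∈ ℝ^{d−1}.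 -/
/-- Extension of a finite vector to `ℕ` by zero. -/
def vext {m : ℕ} (v : Fin m → ℝ) : ℕ → ℝ := fun k => if h : k < m then v ⟨k, h⟩ else 0

/-- The squared euclidean norm `‖v‖²`. -/
noncomputable def sqNorm {m : ℕ} (v : Fin m → ℝ) : ℝ := ∑ k, v k ^ 2

/-- The parabolic translation matrix `M(v) ∈ P_d` (indices `0, …, d` here):
`M(v)_{0,0} = 1`, `M(v)_{0,j} = v_{j-1}` for `1 ≤ j ≤ d-1`, `M(v)_{0,d} = ‖v‖²/2`,
`M(v)_{i,i} = 1` and `M(v)_{i,d} = v_{i-1}` for `1 ≤ i ≤ d-1`, `M(v)_{d,d} = 1`. -/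
noncomputable def Mmat (d : ℕ) (v : Fin (d - 1) → ℝ) :
    Matrix (Fin (d + 1)) (Fin (d + 1)) ℝ :=
  Matrix.of fun i j =>
    if i = j then 1
    else if i.val = 0 ∧ 1 ≤ j.val ∧ j.val ≤ d - 1 then vext v (j.val - 1)
    else if i.val = 0 ∧ j.val = d then sqNorm v / 2
    else if 1 ≤ i.val ∧ i.val ≤ d - 1 ∧ j.val = d then vext v (i.val - 1)
    else 0

/-- The matrix `E(u,b)` (indices `0, …, d` here): `E_{0,0} = 1`, `E_{0,j} = u_{j-1}` for
`1 ≤ j ≤ d-1`, `E_{0,d} = b`, `E_{i,i} = 1` and `E_{i,d} = u_{i-1}` for `1 ≤ i ≤ d-1`,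
`E_{d,d} = 1`, all other entries `0`. -/
def Emat (d : ℕ) (u : Fin (d - 1) → ℝ) (b : ℝ) :
    Matrix (Fin (d + 1)) (Fin (d + 1)) ℝ :=
  Matrix.of fun i j =>
    if i = j then 1
    else if i.val = 0 ∧ 1 ≤ j.val ∧ j.val ≤ d - 1 then vext u (j.val - 1)
    else if i.val = 0 ∧ j.val = d then b
    else if 1 ≤ i.val ∧ i.val ≤ d - 1 ∧ j.val = d then vext u (i.val - 1)
    else 0

theorem Fin.castSucc_succ_ne_last {n : ℕ} (k : Fin n) : k.castSucc.succ ≠ Fin.last (n + 1) :=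
  Fin.ne_of_val_ne (by simpa using k.isLt.ne)

theorem Emat_apply_zero_right {n : ℕ} (u : Fin n → ℝ) (b : ℝ) (i : Fin (n + 2)) :
    Emat (n + 1) u b i 0 = if i = 0 then 1 else 0 := by
  simp [Emat]

theorem Emat_last_apply {n : ℕ} (u : Fin n → ℝ) (b : ℝ) (j : Fin (n + 2)) :
    Emat (n + 1) u b (Fin.last (n + 1)) j = if Fin.last (n + 1) = j then 1 else 0 := by
  simp [Emat]

theorem Emat_zero_mid {n : ℕ} (u : Fin n → ℝ) (b : ℝ) (k : Fin n) :
    Emat (n + 1) u b 0 k.castSucc.succ = u k := by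
  have := (Fin.succ_ne_zero k.castSucc).symm
  simp [Emat, vext, Nat.succ_le_iff, this]

theorem Emat_zero_last {n : ℕ} (u : Fin n → ℝ) (b : ℝ) :
    Emat (n + 1) u b 0 (Fin.last (n + 1)) = b := by
  have : (0 : Fin (n + 2)) ≠ Fin.last (n + 1) := Fin.last_pos.ne
  simp [Emat, this]

theorem Emat_mid_mid {n : ℕ} (u : Fin n → ℝ) (b : ℝ) (k l : Fin n) :
    Emat (n + 1) u b k.castSucc.succ l.castSucc.succ = if k = l then 1 else 0 := by
  simp [Emat, l.isLt.ne]

theorem Emat_mid_last {n : ℕ} (u : Fin n → ℝ) (b : ℝ) (k : Fin n) :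
    Emat (n + 1) u b k.castSucc.succ (Fin.last (n + 1)) = u k := by
  simp [Emat, vext, Nat.succ_le_iff]

theorem Emat_mul_apply_zero {n : ℕ} (u : Fin n → ℝ) (b : ℝ)
    (B : Matrix (Fin (n + 2)) (Fin (n + 2)) ℝ) (j : Fin (n + 2)) :
    (Emat (n + 1) u b * B) 0 j =
      B 0 j + ∑ k, u k * B k.castSucc.succ j + b * B (Fin.last (n + 1)) j := by
  rw [Matrix.mul_apply, Fin.sum_univ_succ, Fin.sum_univ_castSucc, Fin.succ_last]
  simp only [Emat_apply_zero_right, Emat_zero_mid, Emat_zero_last, if_true, one_mul, add_assoc]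

theorem Emat_mul_apply_mid {n : ℕ} (u : Fin n → ℝ) (b : ℝ)
    (B : Matrix (Fin (n + 2)) (Fin (n + 2)) ℝ) (k : Fin n) (j : Fin (n + 2)) :
    (Emat (n + 1) u b * B) k.castSucc.succ j =
      B k.castSucc.succ j + u k * B (Fin.last (n + 1)) j := by
  rw [Matrix.mul_apply, Fin.sum_univ_succ, Fin.sum_univ_castSucc, Fin.succ_last]
  simp [Emat_apply_zero_right, Emat_mid_mid, Emat_mid_last]

theorem Emat_mul_apply_last {n : ℕ} (u : Fin n → ℝ) (b : ℝ)
    (B : Matrix (Fin (n + 2)) (Fin (n + 2)) ℝ) (j : Fin (n + 2)) :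
    (Emat (n + 1) u b * B) (Fin.last (n + 1)) j = B (Fin.last (n + 1)) j := by
  simp [Matrix.mul_apply, Emat_last_apply]

theorem mul_Emat_apply_zero {n : ℕ} (u : Fin n → ℝ) (b : ℝ)
    (B : Matrix (Fin (n + 2)) (Fin (n + 2)) ℝ) (i : Fin (n + 2)) :
    (B * Emat (n + 1) u b) i 0 = B i 0 := by
  simp [Matrix.mul_apply, Emat_apply_zero_right]

theorem mul_Emat_apply_mid {n : ℕ} (u : Fin n → ℝ) (b : ℝ)
    (B : Matrix (Fin (n + 2)) (Fin (n + 2)) ℝ) (i : Fin (n + 2)) (k : Fin n) :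
    (B * Emat (n + 1) u b) i k.castSucc.succ = B i 0 * u k + B i k.castSucc.succ := by
  rw [Matrix.mul_apply, Fin.sum_univ_succ, Fin.sum_univ_castSucc, Fin.succ_last]
  simp [Emat_zero_mid, Emat_mid_mid, Emat_last_apply, (Fin.castSucc_succ_ne_last k).symm]

theorem mul_Emat_apply_last {n : ℕ} (u : Fin n → ℝ) (b : ℝ)
    (B : Matrix (Fin (n + 2)) (Fin (n + 2)) ℝ) (i : Fin (n + 2)) :
    (B * Emat (n + 1) u b) i (Fin.last (n + 1)) =
      B i 0 * b + ∑ k, B i k.castSucc.succ * u k + B i (Fin.last (n + 1)) := by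
  rw [Matrix.mul_apply, Fin.sum_univ_succ, Fin.sum_univ_castSucc, Fin.succ_last]
  simp only [Emat_zero_last, Emat_mid_last, Emat_last_apply, if_true, mul_one, add_assoc]

/-- Entrywise equality of matrices, with indices split into first, middle and last. -/
theorem matrix_ext_first_mid_last {n : ℕ} {A B : Matrix (Fin (n + 2)) (Fin (n + 2)) ℝ}
    (h : ∀ i j, (i = 0 ∨ (∃ k : Fin n, i = k.castSucc.succ) ∨ i = Fin.last (n + 1)) →
      (j = 0 ∨ (∃ k : Fin n, j = k.castSucc.succ) ∨ j = Fin.last (n + 1)) → A i j = B i j) :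
    A = B := by
  have split (i : Fin (n + 2)) :
      i = 0 ∨ (∃ k : Fin n, i = k.castSucc.succ) ∨ i = Fin.last (n + 1) := by
    induction i using Fin.cases with
    | zero => exact .inl rfl
    | succ i =>
      induction i using Fin.lastCases with
      | last => exact .inr (.inr (by simp))
      | cast k => exact .inr (.inl ⟨k, rfl⟩)
  ext i j
  exact h i j (split i) (split j)

theorem Emat_commute {n : ℕ} (u v : Fin n → ℝ) (b q : ℝ) :
    Commute (Emat (n + 1) u b) (Emat (n + 1) v q) := by
  refine matrix_ext_first_mid_last ?_
  rintro i j (rfl | ⟨k, rfl⟩ | rfl) (rfl | ⟨l, rfl⟩ | rfl)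
  all_goals
    simp only [Emat_mul_apply_zero, Emat_mul_apply_mid, Emat_mul_apply_last,
      Emat_apply_zero_right, Emat_last_apply, Emat_zero_mid, Emat_zero_last, Emat_mid_mid,
      Emat_mid_last, (Fin.castSucc_succ_ne_last _).symm, Fin.succ_ne_zero, Fin.last_pos.ne',
      if_true, if_false, mul_ite, mul_one, mul_zero, Finset.sum_ite_eq', Finset.mem_univ,
      Finset.sum_const_zero, add_zero]
  · ring
  · rw [Finset.sum_congr rfl fun k _ => mul_comm (u k) (v k)]
    ring
  · ring

/-- An invertible matrix commuting with some `E(v,q)` for each `v` is a nonzero multiple of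
some `E(u,b)`. -/
theorem exists_eq_smul_Emat_of_commute {n : ℕ} (hn : 0 < n)
    {B : Matrix (Fin (n + 2)) (Fin (n + 2)) ℝ} (hB : IsUnit B) (q : (Fin n → ℝ) → ℝ)
    (h : ∀ v, Commute B (Emat (n + 1) v (q v))) :
    ∃ c : ℝ, c ≠ 0 ∧ ∃ (u : Fin n → ℝ) (b : ℝ), B = c • Emat (n + 1) u b := by
  have e (v : Fin n → ℝ) (i j) : (B * Emat (n + 1) v (q v)) i j =
    (Emat (n + 1) v (q v) * B) i j := by rw [h v]
  have hl0 : B (Fin.last (n + 1)) 0 = 0 := by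
    have := e (Pi.single ⟨0, hn⟩ 1) (Fin.last _) (Fin.castSucc ⟨0, hn⟩).succ
    rw [mul_Emat_apply_mid, Emat_mul_apply_last] at this
    simpa using this
  have hlk (k : Fin n) : B (Fin.last (n + 1)) k.castSucc.succ = 0 := by
    have := e (Pi.single k 1) (Fin.last _) (Fin.last _)
    rw [mul_Emat_apply_last, Emat_mul_apply_last] at this
    simpa [hl0, Pi.single_apply] using this
  have hk0 (k : Fin n) : B k.castSucc.succ 0 = 0 := by
    have := e (Pi.single k 1) 0 0
    rw [mul_Emat_apply_zero, Emat_mul_apply_zero] at this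
    simpa [hl0, Pi.single_apply] using this
  have hkk (k l : Fin n) :
      B k.castSucc.succ l.castSucc.succ = if k = l then B 0 0 else 0 := by
    have := e (Pi.single k 1) 0 l.castSucc.succ
    rw [mul_Emat_apply_mid, Emat_mul_apply_zero] at this
    simp only [hlk, Pi.single_apply, ite_mul, one_mul, zero_mul, Finset.sum_ite_eq',
      Finset.mem_univ, if_true, mul_ite, mul_one, mul_zero, eq_comm (a := l)] at this
    linarith
  have hll : B (Fin.last (n + 1)) (Fin.last (n + 1)) = B 0 0 := by
    have := e (Pi.single ⟨0, hn⟩ 1) (Fin.castSucc ⟨0, hn⟩).succ (Fin.last _)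
    rw [mul_Emat_apply_last, Emat_mul_apply_mid] at this
    simp only [hk0, hkk, Pi.single_apply, mul_ite, mul_one, mul_zero, Finset.sum_ite_eq',
      Finset.mem_univ, if_true] at this
    linarith
  have hkl (k : Fin n) : B k.castSucc.succ (Fin.last (n + 1)) = B 0 k.castSucc.succ := by
    have := e (Pi.single k 1) 0 (Fin.last _)
    rw [mul_Emat_apply_last, Emat_mul_apply_zero] at this
    simp only [hll, Pi.single_apply, ite_mul, one_mul, zero_mul, mul_ite, mul_one, mul_zero,
      Finset.sum_ite_eq', Finset.mem_univ, if_true] at this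
    linarith
  have hc : B 0 0 ≠ 0 := by
    intro h0
    have hdet : B.det = 0 := by
      refine Matrix.det_eq_zero_of_column_eq_zero 0 fun i => ?_
      induction i using Fin.cases with
      | zero => exact h0
      | succ i =>
        induction i using Fin.lastCases with
        | last => simpa using hl0
        | cast k => exact hk0 k
    simpa [hdet] using (Matrix.isUnit_iff_isUnit_det B).mp hB
  refine ⟨B 0 0, hc, fun k => B 0 k.castSucc.succ / B 0 0, B 0 (Fin.last _) / B 0 0, ?_⟩
  refine matrix_ext_first_mid_last ?_
  rintro i j (rfl | ⟨k, rfl⟩ | rfl) (rfl | ⟨l, rfl⟩ | rfl)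
  all_goals
    simp only [Matrix.smul_apply, smul_eq_mul, Emat_apply_zero_right, Emat_last_apply,
      Emat_zero_mid, Emat_zero_last, Emat_mid_mid, Emat_mid_last, hl0, hlk, hk0, hkk, hll, hkl,
      (Fin.castSucc_succ_ne_last _).symm, Fin.succ_ne_zero, Fin.last_pos.ne',
      if_true, if_false, mul_ite, mul_one, mul_zero, mul_div_cancel₀ _ hc]

/-- Comparing traces: a unit commuting up to a scalar with a matrix of nonzero trace
commutes with it. -/
theorem commute_of_mul_eq_smul_of_trace_ne_zero {ι K : Type*} [Fintype ι] [DecidableEq ι]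
    [Field K] {B M : Matrix ι ι K} (hB : IsUnit B) (hM : M.trace ≠ 0) {c : K}
    (h : B * M = c • (M * B)) : Commute B M := by
  obtain ⟨U, rfl⟩ := hB
  have hconj : M = c • (U⁻¹.val * M * U.val) := by
    rw [mul_assoc, ← mul_smul_comm, ← h, ← mul_assoc, Units.inv_mul, one_mul]
  have htr : M.trace = c * M.trace := by
    conv_lhs => rw [hconj, Matrix.trace_smul, Matrix.trace_mul_comm, ← mul_assoc,
      Units.mul_inv, one_mul, smul_eq_mul]
  have hc : c = 1 := (mul_eq_right₀ hM).mp htr.symm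
  rwa [hc, one_smul] at h

/-- Lemma 2.4 (centralizer of `P_d` in `PGL_{d+1}(ℝ)`): an invertible matrix `B` that
projectively commutes with every `M(v)` is a nonzero multiple of some `E(u,b)`;
conversely every nonzero multiple of `E(u,b)` commutes with every `M(v)`. -/
theorem centralizer_Pd (d : ℕ) (hd : 2 ≤ d) :
    (∀ B : Matrix (Fin (d + 1)) (Fin (d + 1)) ℝ, IsUnit B →
        (∀ v : Fin (d - 1) → ℝ, ∃ lam : ℝ, lam ≠ 0 ∧
          B * Mmat d v = lam • (Mmat d v * B)) →
        ∃ c : ℝ, c ≠ 0 ∧ ∃ (u : Fin (d - 1) → ℝ) (b : ℝ), B = c • Emat d u b) ∧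
    (∀ (c : ℝ), c ≠ 0 → ∀ (u : Fin (d - 1) → ℝ) (b : ℝ) (v : Fin (d - 1) → ℝ),
        (c • Emat d u b) * Mmat d v = Mmat d v * (c • Emat d u b)) := by
  obtain ⟨n, rfl⟩ : ∃ n, d = n + 1 := ⟨d - 1, by omega⟩
  refine ⟨fun B hB h => ?_, fun c _ u b v => ?_⟩
  · refine exists_eq_smul_Emat_of_commute (by omega) hB (fun v => sqNorm v / 2) fun v => ?_
    obtain ⟨c, -, hc⟩ := h v
    refine commute_of_mul_eq_smul_of_trace_ne_zero hB ?_ hc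
    simp only [Matrix.trace, Matrix.diag, Emat, Matrix.of_apply, if_true, Finset.sum_const,
      Finset.card_univ, Fintype.card_fin, nsmul_eq_mul, mul_one]
    positivity
  · exact ((Emat_commute u v b (sqNorm v / 2)).smul_left c).eq
end

section
/- Lemma 2.5 (centralizer of P⁰_{d−1} in PGL_{d+1}(ℝ)): let d ≥ 3 and let B be an invertible (d+1)×(d+1) real matrix. Suppose that for every v ∈ ℝ^{d−1} with first component v₁ = 0 there is a nonzero real number λ(v) with B·M(v) = λ(v)·(M(v)·B). Then there exist a nonzero real number κ, real numbers a, c, z, a nonzero real number b, and a vector u ∈ ℝ^{d−2} such that B = κ·F, where F is the matrix with entries F_{1,1} = 1, F_{1,2} = a, F_{1,j} = u_{j−2} for 3 ≤ j ≤ d, F_{1,d+1} = z, F_{2,2} = b, F_{2,d+1} = c, F_{i,i} = 1 and F_{i,d+1} = u_{i−2} for 3 ≤ i ≤ d, F_{d+1,d+1} = 1, and all other entries 0. Conversely, every matrix of the form κ·F with κ ≠ 0 and b ≠ 0 satisfies B·M(v) = M(v)·B for all v with v₁ = 0. -/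
/-- The matrix `F` of Lemma 2.5 (indices `0, …, d` here): `F_{0,0} = 1`, `F_{0,1} = a`,
`F_{0,j} = u_{j-2}` for `2 ≤ j ≤ d-1`, `F_{0,d} = z`, `F_{1,1} = b`, `F_{1,d} = c`,
`F_{i,i} = 1` and `F_{i,d} = u_{i-2}` for `2 ≤ i ≤ d-1`, `F_{d,d} = 1`, other entries `0`. -/
def Fmat (d : ℕ) (a b c z : ℝ) (u : Fin (d - 2) → ℝ) :
    Matrix (Fin (d + 1)) (Fin (d + 1)) ℝ :=
  Matrix.of fun i j =>
    if i = j then (if i.val = 1 then b else 1)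
    else if i.val = 0 ∧ j.val = 1 then a
    else if i.val = 0 ∧ 2 ≤ j.val ∧ j.val ≤ d - 1 then vext u (j.val - 2)
    else if i.val = 0 ∧ j.val = d then z
    else if i.val = 1 ∧ j.val = d then c
    else if 2 ≤ i.val ∧ i.val ≤ d - 1 ∧ j.val = d then vext u (i.val - 2)
    else 0

/-- The generator `E_{0,k+1} + E_{k+1,d}` of the Lie algebra of `P_d`. -/
def transGen (d : ℕ) (k : Fin (d - 1)) : Matrix (Fin (d + 1)) (Fin (d + 1)) ℝ :=
  Matrix.single 0 ⟨k + 1, by omega⟩ 1 + Matrix.single ⟨k + 1, by omega⟩ (Fin.last d) 1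

theorem mul_single_one_apply {n : ℕ} (B : Matrix (Fin n) (Fin n) ℝ) (p q i j : Fin n) :
    (B * Matrix.single p q (1 : ℝ)) i j = if j = q then B i p else 0 := by
  simp [Matrix.mul_apply, Matrix.single_apply, ite_and, eq_comm]

theorem single_one_mul_apply {n : ℕ} (B : Matrix (Fin n) (Fin n) ℝ) (p q i j : Fin n) :
    (Matrix.single p q (1 : ℝ) * B) i j = if i = p then B q j else 0 := by
  simp [Matrix.mul_apply, Matrix.single_apply, ite_and, eq_comm]

theorem commute_single_iff {n : ℕ} (B : Matrix (Fin n) (Fin n) ℝ) (p q : Fin n) :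
    Commute B (Matrix.single p q 1) ↔
      ∀ i j, (if j = q then B i p else 0) = if i = p then B q j else 0 := by
  simp only [commute_iff_eq, ← Matrix.ext_iff, mul_single_one_apply, single_one_mul_apply]

theorem commute_transGen_iff {d : ℕ} (B : Matrix (Fin (d + 1)) (Fin (d + 1)) ℝ)
    (k : Fin (d - 1)) :
    Commute B (transGen d k) ↔ ∀ i j,
      (if j = ⟨k + 1, by omega⟩ then B i 0 else 0) +
        (if j = Fin.last d then B i ⟨k + 1, by omega⟩ else 0) =
      (if i = 0 then B ⟨k + 1, by omega⟩ j else 0) +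
        (if i = ⟨k + 1, by omega⟩ then B (Fin.last d) j else 0) := by
  simp only [commute_iff_eq, ← Matrix.ext_iff, transGen, mul_add, add_mul, Matrix.add_apply,
    mul_single_one_apply, single_one_mul_apply]

theorem sum_mul_ite_succ_eq_vext {m : ℕ} (v : Fin m → ℝ) (j : ℕ) (hj : 1 ≤ j) :
    (∑ k, if j = k.val + 1 then v k else 0) = vext v (j - 1) := by
  unfold vext
  split_ifs with h
  · rw [Finset.sum_eq_single ⟨j - 1, h⟩]
    · rw [if_pos (by simp; omega)]
    · intro b _ hb
      rw [if_neg]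
      rintro rfl
      simp at hb
    · simp
  · refine Finset.sum_eq_zero fun k _ => if_neg ?_
    omega

theorem Mmat_eq {d : ℕ} (hd : 1 ≤ d) (v : Fin (d - 1) → ℝ) :
    Mmat d v = 1 + ∑ k, v k • transGen d k +
      (sqNorm v / 2) • Matrix.single 0 (Fin.last d) 1 := by
  ext i j
  have key : (∑ k, v k • transGen d k) i j =
      (if i.val = 0 then ∑ k, (if j.val = k.val + 1 then v k else 0) else 0) +
      (if j.val = d then ∑ k, (if i.val = k.val + 1 then v k else 0) else 0) := by
    simp only [Matrix.sum_apply, Matrix.smul_apply, transGen, Matrix.add_apply,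
      Matrix.single_apply, smul_eq_mul, mul_add, Finset.sum_add_distrib]
    congr 1
    · split_ifs with h
      · refine Finset.sum_congr rfl fun k _ => ?_
        simp [Fin.ext_iff, h, eq_comm]
      · refine Finset.sum_eq_zero fun k _ => ?_
        rw [if_neg (by simp [Fin.ext_iff]; omega), mul_zero]
    · split_ifs with h
      · refine Finset.sum_congr rfl fun k _ => ?_
        simp [Fin.ext_iff, h, eq_comm]
      · refine Finset.sum_eq_zero fun k _ => ?_
        rw [if_neg (by simp [Fin.ext_iff]; omega), mul_zero]
  have hz : ∀ n : ℕ, n = 0 ∨ d ≤ n → (∑ k : Fin (d - 1), if n = k.val + 1 then v k else 0) = 0 :=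
    fun n hn => Finset.sum_eq_zero fun k _ => if_neg (by omega)
  have hi := i.isLt
  have hj := j.isLt
  rw [Matrix.add_apply, Matrix.add_apply, key]
  simp only [Mmat, Matrix.of_apply, Matrix.one_apply, Matrix.smul_apply, Matrix.single_apply,
    Fin.ext_iff, Fin.val_zero, Fin.val_last, smul_eq_mul]
  rcases Nat.eq_zero_or_pos i.val with hi0 | hi0 <;>
    rcases Nat.eq_zero_or_pos j.val with hj0 | hj0 <;>
    by_cases hid : i.val = d <;> by_cases hjd : j.val = d <;>
    by_cases hij : i.val = j.val <;> try omega
  all_goals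
    try rw [hz i.val (by omega)]
    try rw [hz j.val (by omega)]
    try rw [sum_mul_ite_succ_eq_vext v i.val (by omega)]
    try rw [sum_mul_ite_succ_eq_vext v j.val (by omega)]
    split_ifs <;> first | omega | simp

theorem eq_one_of_mul_eq_smul_mul {n : ℕ} {B M : Matrix (Fin n) (Fin n) ℝ} (hB : IsUnit B)
    (hM : M.trace ≠ 0) {r : ℝ} (h : B * M = r • (M * B)) : r = 1 := by
  obtain ⟨u, rfl⟩ := hB
  have h2 : M = r • ((↑u⁻¹ : Matrix (Fin n) (Fin n) ℝ) * (M * u)) := by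
    rw [← Matrix.mul_smul, ← h, Units.inv_mul_cancel_left]
  have h3 : M.trace = r * M.trace := by
    conv_lhs => rw [h2]
    rw [Matrix.trace_smul, Matrix.trace_mul_comm, mul_assoc, Units.mul_inv, mul_one, smul_eq_mul]
  exact (mul_right_cancel₀ hM (by rw [one_mul, ← h3])).symm

theorem trace_Mmat (d : ℕ) (v : Fin (d - 1) → ℝ) : (Mmat d v).trace = d + 1 := by
  simp [Matrix.trace, Mmat]

theorem sqNorm_single {m : ℕ} (k : Fin m) (t : ℝ) : sqNorm (Pi.single k t) = t ^ 2 := by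
  rw [sqNorm, Finset.sum_eq_single k] <;> simp +contextual

theorem Mmat_single {d : ℕ} (hd : 1 ≤ d) (k : Fin (d - 1)) (t : ℝ) :
    Mmat d (Pi.single k t) = 1 + t • transGen d k +
      (t ^ 2 / 2) • Matrix.single 0 (Fin.last d) 1 := by
  rw [Mmat_eq hd, sqNorm_single, Finset.sum_eq_single k] <;> simp +contextual

theorem commute_gens_of_commute_Mmat {d : ℕ} (hd : 1 ≤ d) {k : Fin (d - 1)}
    {B : Matrix (Fin (d + 1)) (Fin (d + 1)) ℝ}
    (h : ∀ t, Commute B (Mmat d (Pi.single k t))) :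
    Commute B (transGen d k) ∧ Commute B (Matrix.single 0 (Fin.last d) 1) := by
  have hA : transGen d k = (1 / 2 : ℝ) •
      (Mmat d (Pi.single k 1) - Mmat d (Pi.single k (-1))) := by
    rw [Mmat_single hd, Mmat_single hd]
    module
  have hE : Matrix.single 0 (Fin.last d) 1 =
      Mmat d (Pi.single k 1) + Mmat d (Pi.single k (-1)) - (2 : ℝ) • 1 := by
    rw [Mmat_single hd, Mmat_single hd]
    module
  constructor
  · rw [hA]
    exact ((h 1).sub_right (h (-1))).smul_right _
  · rw [hE]
    exact ((h 1).add_right (h (-1))).sub_right ((Commute.one_right B).smul_right _)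

theorem commute_Mmat_of_commute_gens {d : ℕ} (hd : 1 ≤ d) {v : Fin (d - 1) → ℝ}
    {B : Matrix (Fin (d + 1)) (Fin (d + 1)) ℝ}
    (hA : ∀ k, v k ≠ 0 → Commute B (transGen d k))
    (hE : Commute B (Matrix.single 0 (Fin.last d) 1)) : Commute B (Mmat d v) := by
  rw [Mmat_eq hd]
  refine ((Commute.one_right B).add_right (Commute.sum_right _ _ _ fun k _ => ?_)).add_right
    (hE.smul_right _)
  by_cases hk : v k = 0
  · simp [hk]
  · exact (hA k hk).smul_right _

theorem Fmat_apply_zero {d : ℕ} (a b c z : ℝ) (u : Fin (d - 2) → ℝ) (hd : 1 ≤ d)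
    (i : Fin (d + 1)) : Fmat d a b c z u i 0 = if i = 0 then 1 else 0 := by
  have h0 : (0 : Fin (d + 1)).val = 0 := rfl
  generalize (0 : Fin (d + 1)) = o at h0 ⊢
  simp only [Fmat, Matrix.of_apply, Fin.ext_iff]
  split_ifs <;> first | rfl | omega

theorem Fmat_last_apply {d : ℕ} (a b c z : ℝ) (u : Fin (d - 2) → ℝ) (hd : 2 ≤ d)
    (j : Fin (d + 1)) :
    Fmat d a b c z u (Fin.last d) j = if j = Fin.last d then 1 else 0 := by
  simp only [Fmat, Matrix.of_apply, Fin.ext_iff, Fin.val_last]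
  split_ifs <;> first | rfl | omega

theorem Fmat_apply_mid {d : ℕ} (a b c z : ℝ) (u : Fin (d - 2) → ℝ) {k : Fin (d + 1)}
    (hk : 2 ≤ k.val) (hkd : k.val < d) (i : Fin (d + 1)) :
    Fmat d a b c z u i k = if i = k then 1 else if i = 0 then vext u (k.val - 2) else 0 := by
  simp only [Fmat, Matrix.of_apply, Fin.ext_iff, Fin.val_zero]
  split_ifs <;> first | rfl | omega

theorem Fmat_mid_apply {d : ℕ} (a b c z : ℝ) (u : Fin (d - 2) → ℝ) {k : Fin (d + 1)}
    (hk : 2 ≤ k.val) (hkd : k.val < d) (j : Fin (d + 1)) :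
    Fmat d a b c z u k j =
      if j = k then 1 else if j = Fin.last d then vext u (k.val - 2) else 0 := by
  simp only [Fmat, Matrix.of_apply, Fin.ext_iff, Fin.val_last]
  split_ifs <;> first | rfl | omega

theorem Fmat_commute_single {d : ℕ} (hd : 2 ≤ d) (a b c z : ℝ) (u : Fin (d - 2) → ℝ) :
    Commute (Fmat d a b c z u) (Matrix.single 0 (Fin.last d) 1) := by
  rw [commute_single_iff]
  intro i j
  rw [Fmat_apply_zero _ _ _ _ _ (by omega), Fmat_last_apply _ _ _ _ _ hd]
  split_ifs <;> rfl

theorem Fmat_commute_transGen {d : ℕ} (a b c z : ℝ) (u : Fin (d - 2) → ℝ)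
    (k : Fin (d - 1)) (hk : 1 ≤ k.val) : Commute (Fmat d a b c z u) (transGen d k) := by
  rw [commute_transGen_iff]
  intro i j
  have hk2 : 2 ≤ (⟨k + 1, by omega⟩ : Fin (d + 1)).val := by simpa using hk
  have hkd : (⟨k + 1, by omega⟩ : Fin (d + 1)).val < d := by simp; omega
  rw [Fmat_apply_zero _ _ _ _ _ (by omega), Fmat_last_apply _ _ _ _ _ (by omega),
    Fmat_apply_mid _ _ _ _ _ hk2 hkd, Fmat_mid_apply _ _ _ _ _ hk2 hkd]
  simp only [Fin.ext_iff, Fin.val_zero, Fin.val_last] at hkd ⊢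
  split_ifs <;> first | omega | simp

theorem eq_smul_Fmat_of_commute {d : ℕ} (hd : 3 ≤ d)
    {B : Matrix (Fin (d + 1)) (Fin (d + 1)) ℝ} (hB : IsUnit B)
    (hA : ∀ k : Fin (d - 1), 1 ≤ k.val → Commute B (transGen d k))
    (hE : Commute B (Matrix.single 0 (Fin.last d) 1)) :
    ∃ κ : ℝ, κ ≠ 0 ∧ ∃ (a c z : ℝ) (b : ℝ), b ≠ 0 ∧ ∃ u : Fin (d - 2) → ℝ,
      B = κ • Fmat d a b c z u := by
  rw [commute_single_iff] at hE
  simp only [commute_transGen_iff] at hA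
  have hlast : Fin.last d ≠ 0 := by simp [Fin.ext_iff]; omega
  have col0 : ∀ i, i ≠ 0 → B i 0 = 0 := fun i hi => by simpa [hi] using hE i (Fin.last d)
  have rowd : ∀ j, j ≠ Fin.last d → B (Fin.last d) j = 0 := fun j hj => by
    simpa [hj] using (hE 0 j).symm
  have hdd : B (Fin.last d) (Fin.last d) = B 0 0 := by simpa using (hE 0 (Fin.last d)).symm
  have hA' : ∀ (k : Fin (d + 1)), 2 ≤ k.val → k.val < d → ∀ i j,
      (if j = k then B i 0 else 0) + (if j = Fin.last d then B i k else 0) =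
      (if i = 0 then B k j else 0) + (if i = k then B (Fin.last d) j else 0) := by
    intro k h2 hkd
    have hk : k = ⟨(⟨k.val - 1, by omega⟩ : Fin (d - 1)).val + 1, by simp; omega⟩ := by
      ext; simp; omega
    have := hA ⟨k.val - 1, by omega⟩ (by simp; omega)
    rwa [← hk] at this
  have diag : ∀ k : Fin (d + 1), 2 ≤ k.val → k.val < d → B k k = B 0 0 := by
    intro k h2 hkd
    have h0 : k ≠ 0 := by rintro rfl; simp at h2
    have hl : k ≠ Fin.last d := by rintro rfl; simp at hkd
    simpa [h0.symm, hl] using (hA' k h2 hkd 0 k).symm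
  have row : ∀ k : Fin (d + 1), 2 ≤ k.val → k.val < d → ∀ j, j ≠ k → j ≠ Fin.last d →
      B k j = 0 := by
    intro k h2 hkd j hj hjd
    have h0 : k ≠ 0 := by rintro rfl; simp at h2
    simpa [h0.symm, hj, hjd] using (hA' k h2 hkd 0 j).symm
  have col : ∀ k : Fin (d + 1), 2 ≤ k.val → k.val < d → ∀ i, i ≠ k → i ≠ 0 →
      B i k = 0 := by
    intro k h2 hkd i hi hi0
    have hl : k ≠ Fin.last d := by rintro rfl; simp at hkd
    simpa [hl.symm, hi, hi0] using hA' k h2 hkd i (Fin.last d)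
  have cross : ∀ k : Fin (d + 1), 2 ≤ k.val → k.val < d → B k (Fin.last d) = B 0 k := by
    intro k h2 hkd
    have h0 : k ≠ 0 := by rintro rfl; simp at h2
    have hl : k ≠ Fin.last d := by rintro rfl; simp at hkd
    simpa [hl.symm, h0.symm] using (hA' k h2 hkd 0 (Fin.last d)).symm
  have hinj : ∀ w, B.mulVec w = 0 → w = 0 := fun w hw =>
    Matrix.mulVec_injective_of_isUnit hB (by simpa using hw)
  have hκ : B 0 0 ≠ 0 := by
    intro h
    have := congrFun (hinj (Pi.single 0 1) (by
      ext i
      by_cases hi : i = 0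
      · simp [hi, h]
      · simp [col0 i hi])) 0
    simp at this
  let e : Fin (d + 1) := ⟨1, by omega⟩
  have he0 : e ≠ 0 := by simp [e, Fin.ext_iff]
  have hed : e ≠ Fin.last d := by simp [e, Fin.ext_iff]; omega
  have hb : B e e ≠ 0 := by
    intro h
    have hcol : ∀ i, i ≠ 0 → B i e = 0 := by
      intro i hi
      by_cases hie : i = e
      · rw [hie, h]
      by_cases hid : i = Fin.last d
      · rw [hid, rowd e hed]
      have : i.val ≠ 0 ∧ i.val ≠ 1 ∧ i.val ≠ d :=
        ⟨fun h => hi (Fin.ext h), fun h => hie (Fin.ext h), fun h => hid (Fin.ext h)⟩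
      exact row i (by omega) (by omega) e (Ne.symm hie) hed
    have := congrFun (hinj (B 0 0 • Pi.single e 1 - B 0 e • Pi.single 0 1) (by
      ext i
      rw [Matrix.mulVec_sub, Matrix.mulVec_smul, Matrix.mulVec_smul]
      by_cases hi : i = 0
      · simp [hi, mul_comm]
      · simp [col0 i hi, hcol i hi])) e
    simp [he0, hκ] at this
  refine ⟨B 0 0, hκ, B 0 e / B 0 0, B e (Fin.last d) / B 0 0, B 0 (Fin.last d) / B 0 0,
    B e e / B 0 0, div_ne_zero hb hκ, fun k => B 0 ⟨k.val + 2, by omega⟩ / B 0 0, ?_⟩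
  ext i j
  have hi := i.isLt
  have hj := j.isLt
  have hvext : ∀ k : Fin (d + 1), 2 ≤ k.val → k.val ≤ d - 1 →
      vext (fun k : Fin (d - 2) => B 0 ⟨k.val + 2, by omega⟩ / B 0 0) (k.val - 2) =
        B 0 k / B 0 0 := by
    intro k h2 hk
    rw [vext, dif_pos (by omega)]
    congr 2
    ext
    simp; omega
  simp only [Fmat, Matrix.smul_apply, Matrix.of_apply, smul_eq_mul]
  split_ifs with h1 h2 h3 h4 h5 h6 h7
  · obtain rfl : i = e := Fin.ext h2
    rw [← h1, mul_div_cancel₀ _ hκ]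
  · subst h1
    rw [mul_one]
    by_cases hi0 : i = 0
    · rw [hi0]
    by_cases hid : i = Fin.last d
    · rw [hid, hdd]
    have : i.val ≠ 0 ∧ i.val ≠ d := ⟨fun h => hi0 (Fin.ext h), fun h => hid (Fin.ext h)⟩
    exact diag i (by omega) (by omega)
  · obtain rfl : i = 0 := Fin.ext h3.1
    obtain rfl : j = e := Fin.ext h3.2
    rw [mul_div_cancel₀ _ hκ]
  · obtain rfl : i = 0 := Fin.ext h4.1
    rw [hvext j h4.2.1 h4.2.2, mul_div_cancel₀ _ hκ]
  · obtain rfl : i = 0 := Fin.ext h5.1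
    obtain rfl : j = Fin.last d := Fin.ext h5.2
    rw [mul_div_cancel₀ _ hκ]
  · obtain rfl : i = e := Fin.ext h6.1
    obtain rfl : j = Fin.last d := Fin.ext h6.2
    rw [mul_div_cancel₀ _ hκ]
  · obtain rfl : j = Fin.last d := Fin.ext h7.2.2
    rw [hvext i h7.1 h7.2.1, mul_div_cancel₀ _ hκ, cross i h7.1 (by omega)]
  · rw [mul_zero]
    have hij : i.val ≠ j.val := fun h => h1 (Fin.ext h)
    by_cases hj0 : j = 0
    · rw [hj0]
      exact col0 i (hj0 ▸ h1)
    have hj0' : j.val ≠ 0 := fun h => hj0 (Fin.ext h)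
    have hi0 : i ≠ 0 := by
      rintro rfl
      simp at h3 h4 h5
      omega
    have hi0' : i.val ≠ 0 := fun h => hi0 (Fin.ext h)
    by_cases hid : i = Fin.last d
    · rw [hid]
      exact rowd j (hid ▸ Ne.symm h1)
    have hid' : i.val ≠ d := fun h => hid (Fin.ext h)
    have hjd' : j.val ≠ d := by omega
    by_cases hi1 : i.val = 1
    · exact col j (by omega) (by omega) i h1 hi0
    · exact row i (by omega) (by omega) j (Ne.symm h1) fun h => hjd' (by simp [h])

/-- Lemma 2.5 (centralizer of `P⁰_{d−1}` in `PGL_{d+1}(ℝ)`): an invertible matrix `B`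
that projectively commutes with every `M(v)` having first component `v₁ = 0` is a nonzero
multiple of some `F`; conversely every such nonzero multiple (with `b ≠ 0`) commutes
with every `M(v)` having `v₁ = 0`. -/
theorem centralizer_P0dminus1 (d : ℕ) (hd : 3 ≤ d) :
    (∀ B : Matrix (Fin (d + 1)) (Fin (d + 1)) ℝ, IsUnit B →
        (∀ v : Fin (d - 1) → ℝ, v ⟨0, by omega⟩ = 0 →
          ∃ lam : ℝ, lam ≠ 0 ∧ B * Mmat d v = lam • (Mmat d v * B)) →
        ∃ κ : ℝ, κ ≠ 0 ∧ ∃ (a c z : ℝ) (b : ℝ), b ≠ 0 ∧ ∃ u : Fin (d - 2) → ℝ,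
          B = κ • Fmat d a b c z u) ∧
    (∀ (κ : ℝ), κ ≠ 0 → ∀ (a c z b : ℝ), b ≠ 0 → ∀ (u : Fin (d - 2) → ℝ)
        (v : Fin (d - 1) → ℝ), v ⟨0, by omega⟩ = 0 →
        (κ • Fmat d a b c z u) * Mmat d v = Mmat d v * (κ • Fmat d a b c z u)) := by
  refine ⟨fun B hB h => ?_, fun κ _ a c z b _ u v hv => ?_⟩
  · have hcomm : ∀ k : Fin (d - 1), 1 ≤ k.val → ∀ t, Commute B (Mmat d (Pi.single k t)) := by
      intro k hk t
      have hk0 : (⟨0, by omega⟩ : Fin (d - 1)) ≠ k := by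
        intro h0
        simp [← h0] at hk
      obtain ⟨r, -, hr⟩ := h (Pi.single k t) (by simp [Pi.single_eq_of_ne hk0])
      have hr1 := eq_one_of_mul_eq_smul_mul hB (by rw [trace_Mmat]; positivity) hr
      rwa [hr1, one_smul] at hr
    exact eq_smul_Fmat_of_commute hd hB
      (fun k hk => (commute_gens_of_commute_Mmat (by omega) (hcomm k hk)).1)
      (commute_gens_of_commute_Mmat (by omega) (hcomm ⟨1, by omega⟩ le_rfl)).2
  · refine (commute_Mmat_of_commute_gens (by omega) (fun k hk => ?_)
      (Fmat_commute_single (by omega) a b c z u)).smul_left κ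
    refine Fmat_commute_transGen a b c z u k (Nat.one_le_iff_ne_zero.mpr fun h0 => hk ?_)
    rwa [show k = ⟨0, by omega⟩ from Fin.ext h0]
end

section
/- Orbit convergence claim from the proof of Lemma 5.1: let d ≥ 3 and let p ∈ ℝ^{d+1} with last coordinate p_{d+1} = 1. If (aₙ) is a sequence of real numbers with |aₙ| → ∞ and (uₙ) is a bounded sequence in ℝ^{d−2}, then the normalized orbit vectors (M'(aₙ,uₙ)·p)/‖M'(aₙ,uₙ)·p‖ converge to −e₁, the negative of the first standard basis vector of ℝ^{d+1} (i.e. the orbit β_n·p converges to the point [−e₁] of the projective sphere S^d). -/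
/-- The matrix `M'(a,u) ∈ P'_d` (indices `0, …, d` here). -/
noncomputable def Mpmat (d : ℕ) (a : ℝ) (u : Fin (d - 2) → ℝ) :
    Matrix (Fin (d + 1)) (Fin (d + 1)) ℝ :=
  Matrix.of fun i j =>
    if i = j then 1
    else if i.val = 0 ∧ j.val = 1 then a
    else if i.val = 0 ∧ 2 ≤ j.val ∧ j.val ≤ d - 1 then vext u (j.val - 2)
    else if i.val = 0 ∧ j.val = d then (-a ^ 2 + sqNorm u) / 2
    else if i.val = 1 ∧ j.val = d then -a
    else if 2 ≤ i.val ∧ i.val ≤ d - 1 ∧ j.val = d then vext u (i.val - 2)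
    else 0

/-- The euclidean norm on `ℝ^{d+1}`. -/
noncomputable def eNorm (d : ℕ) (x : Fin (d + 1) → ℝ) : ℝ := Real.sqrt (∑ i, x i ^ 2)

/-- The first standard basis vector `e₁` of `ℝ^{d+1}`. -/
def stdE1 (d : ℕ) : Fin (d + 1) → ℝ := fun k => if k.val = 0 then 1 else 0

open Filter Topology in
/-- A scalar sequence tending to zero times a bounded sequence tends to zero. -/
theorem tendsto_mul_zero_of_abs_le {t b : ℕ → ℝ} {C : ℝ} (ht : Tendsto t atTop (𝓝 0))
    (hb : ∀ n, |b n| ≤ C) : Tendsto (fun n => t n * b n) atTop (𝓝 0) :=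
  ht.zero_mul_isBoundedUnder_le (isBoundedUnder_of ⟨C, hb⟩)

theorem sqNorm_nonneg {m : ℕ} (v : Fin m → ℝ) : 0 ≤ sqNorm v :=
  Finset.sum_nonneg fun _ _ => sq_nonneg _

theorem abs_vext_le {m : ℕ} (v : Fin m → ℝ) (k : ℕ) : |vext v k| ≤ Real.sqrt (sqNorm v) := by
  unfold vext
  split_ifs with h
  · exact Real.abs_le_sqrt
      (Finset.single_le_sum (f := fun i => v i ^ 2) (fun _ _ => sq_nonneg _) (Finset.mem_univ _))
  · simp

open Filter Topology in
/-- After division by `a²`, the entries of `M'(a,u)` all tend to zero except for the top right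
one, which tends to `-1/2`. -/
theorem tendsto_inv_sq_mul_Mpmat {d : ℕ} (hd : 3 ≤ d) {a : ℕ → ℝ} {u : ℕ → Fin (d - 2) → ℝ}
    (ha : Tendsto (fun n => |a n|) atTop atTop)
    {C : ℝ} (hu : ∀ n, Real.sqrt (sqNorm (u n)) ≤ C) (i j : Fin (d + 1)) :
    Tendsto (fun n => (a n ^ 2)⁻¹ * Mpmat d (a n) (u n) i j) atTop
      (𝓝 (if i.val = 0 ∧ j.val = d then -(1 / 2) else 0)) := by
  have hsq : Tendsto (fun n => (a n ^ 2)⁻¹) atTop (𝓝 0) := by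
    simpa [Function.comp_def, Pi.inv_def] using
      ((tendsto_pow_atTop two_ne_zero).comp ha).inv_tendsto_atTop
  have hinv : Tendsto (fun n => (a n)⁻¹) atTop (𝓝 0) :=
    (tendsto_zero_iff_abs_tendsto_zero _).2
      (by simpa [Function.comp_def, Pi.inv_def, abs_inv] using ha.inv_tendsto_atTop)
  have hmul : ∀ n, (a n ^ 2)⁻¹ * a n = (a n)⁻¹ := fun n => by
    rcases eq_or_ne (a n) 0 with h | h
    · simp [h]
    · field_simp
  have hv : ∀ k, Tendsto (fun n => (a n ^ 2)⁻¹ * vext (u n) k) atTop (𝓝 0) := fun k =>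
    tendsto_mul_zero_of_abs_le hsq fun n => (abs_vext_le _ k).trans (hu n)
  by_cases hij : i = j
  · have h : ¬(i.val = 0 ∧ j.val = d) := by subst hij; omega
    rw [if_neg h]
    simpa [Mpmat, hij] using hsq
  simp only [Mpmat, Matrix.of_apply, if_neg hij]
  split_ifs <;> first | omega | skip
  · simpa only [hmul] using hinv
  · exact hv _
  · have hs : Tendsto (fun n => (a n ^ 2)⁻¹ * sqNorm (u n)) atTop (𝓝 0) :=
      tendsto_mul_zero_of_abs_le (C := C ^ 2) hsq fun n => by
        rw [abs_of_nonneg (sqNorm_nonneg _), ← Real.sq_sqrt (sqNorm_nonneg (u n))]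
        exact pow_le_pow_left₀ (Real.sqrt_nonneg _) (hu n) 2
    have h := (hs.div_const 2).const_add (-(1 / 2))
    rw [zero_div, add_zero] at h
    refine h.congr' ?_
    filter_upwards [ha.eventually_gt_atTop 0] with n hn
    have : a n ≠ 0 := abs_pos.1 hn
    field_simp
  · simpa only [mul_neg, hmul, neg_zero] using hinv.neg
  · exact hv _
  · simp

theorem eNorm_smul (d : ℕ) {c : ℝ} (hc : 0 ≤ c) (x : Fin (d + 1) → ℝ) :
    eNorm d (c • x) = c * eNorm d x := by
  simp only [eNorm, Pi.smul_apply, smul_eq_mul, mul_pow, ← Finset.mul_sum]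
  rw [Real.sqrt_mul (sq_nonneg c), Real.sqrt_sq hc]

theorem continuous_eNorm (d : ℕ) : Continuous (eNorm d) := by
  unfold eNorm
  fun_prop

theorem inv_eNorm_smul_smul (d : ℕ) {c : ℝ} (hc : 0 < c) (x : Fin (d + 1) → ℝ) :
    (eNorm d (c • x))⁻¹ • c • x = (eNorm d x)⁻¹ • x := by
  rw [eNorm_smul d hc.le, smul_smul, mul_inv, mul_right_comm, inv_mul_cancel₀ hc.ne', one_mul]

theorem eNorm_neg_stdE1 (d : ℕ) : eNorm d (-stdE1 d) = 1 := by
  simp [eNorm, stdE1]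


/-- Orbit convergence claim from the proof of Lemma 5.1: for `p` in the affine patch
`p_{d+1} = 1`, if `|aₙ| → ∞` and `(uₙ)` is bounded, then the euclidean-normalized
vectors `M'(aₙ,uₙ)·p / ‖M'(aₙ,uₙ)·p‖` converge to `−e₁`. -/
theorem Ppd_orbit_tendsto_neg_e1 (d : ℕ) (hd : 3 ≤ d)
    (p : Fin (d + 1) → ℝ) (hp : p (Fin.last d) = 1)
    (a : ℕ → ℝ) (u : ℕ → Fin (d - 2) → ℝ)
    (ha : Filter.Tendsto (fun n => |a n|) Filter.atTop Filter.atTop)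
    (hu : ∃ Cb : ℝ, ∀ n, Real.sqrt (∑ i, u n i ^ 2) ≤ Cb) :
    Filter.Tendsto
      (fun n => (eNorm d ((Mpmat d (a n) (u n)).mulVec p))⁻¹ •
        (Mpmat d (a n) (u n)).mulVec p)
      Filter.atTop (nhds (-(stdE1 d))) := by
  obtain ⟨C, hC⟩ := hu
  have hlim : Filter.Tendsto (fun n => (a n ^ 2)⁻¹ • (Mpmat d (a n) (u n)).mulVec p)
      Filter.atTop (nhds ((1 / 2 : ℝ) • -stdE1 d)) := by
    refine tendsto_pi_nhds.2 fun i => ?_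
    have h := tendsto_finsetSum Finset.univ fun j _ =>
      (tendsto_inv_sq_mul_Mpmat hd ha hC i j).mul_const (p j)
    have hval : ∑ j : Fin (d + 1), (if i.val = 0 ∧ j.val = d then -(1 / 2) else 0) * p j =
        ((1 / 2 : ℝ) • -stdE1 d) i := by
      rw [Finset.sum_eq_single (Fin.last d)]
      · by_cases hi : i = 0 <;> simp [hp, stdE1, hi]
      · intro j _ hj
        have : j.val ≠ d := fun h => hj (Fin.ext h)
        simp [this]
      · simp
    rw [hval] at h
    simpa only [Pi.smul_apply, smul_eq_mul, Matrix.mulVec, dotProduct, Finset.mul_sum,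
      mul_assoc] using h
  have hnorm : eNorm d ((1 / 2 : ℝ) • -stdE1 d) ≠ 0 := by
    rw [eNorm_smul d (c := 1 / 2) (by norm_num), eNorm_neg_stdE1]
    norm_num
  have h := ((((continuous_eNorm d).tendsto _).comp hlim).inv₀ hnorm).smul hlim
  rw [inv_eNorm_smul_smul d (c := 1 / 2) (by norm_num), eNorm_neg_stdE1, inv_one, one_smul] at h
  refine h.congr' ?_
  filter_upwards [ha.eventually_gt_atTop 0] with n hn
  have : a n ≠ 0 := abs_pos.1 hn
  exact inv_eNorm_smul_smul d (by positivity) _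
end
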